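/- Let c = (c₁,…,c_n) be a tuple of nonnegative integers and let w ∈ W_c. Then fast(w) = Id_c if and only if w avoids the pattern 231. -/

import Mathlib

lemma foldr_max_mem {w : List ℕ} (h : w ≠ []) : w.foldr max 0 ∈ w := by
  induction w with
  | nil => exact absurd rfl h
  | cons a l ih =>
    rcases eq_or_ne l [] with rfl | hl
    · simp
    · have hm := ih hl
      simp only [List.foldr_cons]
      rcases max_choice a (l.foldr max 0) with h' | h' <;> rw [h']
      · exact List.mem_cons_self
      · exact List.mem_cons_of_mem _ hm

lemma headI_mem {α : Type*} [Inhabited α] {l : List α} (h : l ≠ []) : l.headI ∈ l := by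
  cases l with
  | nil => exact absurd rfl h
  | cons a t => simp

/-- `blocks n w` is the list of maximal (possibly empty) blocks of `w`
separated by occurrences of the letter `n`; that is, if `n` occurs `k` times
in `w`, then `blocks n w = [A₁, A₂, …, A_{k+1}]` where `w = A₁ n A₂ n ⋯ n A_{k+1}`
and no `Aᵢ` contains the letter `n`. -/
def blocks (n : ℕ) : List ℕ → List (List ℕ)
  | [] => [[]]
  | a :: l =>
    if a = n then [] :: blocks n l
    else (a :: (blocks n l).headI) :: (blocks n l).tail

lemma blocks_ne_nil (n : ℕ) (w : List ℕ) : blocks n w ≠ [] := by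
  cases w with
  | nil => simp [blocks]
  | cons a l =>
    simp only [blocks]
    split <;> simp

lemma blocks_length {n : ℕ} {w : List ℕ} : ∀ {A : List ℕ}, A ∈ blocks n w →
    A.length + w.count n ≤ w.length := by
  induction w with
  | nil =>
    intro A hA
    simp only [blocks, List.mem_singleton] at hA
    subst hA; simp
  | cons a l ih =>
    intro A hA
    by_cases h : a = n
    · subst h
      simp only [blocks, if_pos rfl] at hA
      have hcc : (a :: l).count a = l.count a + 1 := by simp
      cases hA with
      | head =>
        have := List.count_le_length (a := a) (l := l)
        simp only [List.length_nil, List.length_cons, hcc]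
        omega
      | tail _ h1 =>
        have := ih h1
        simp only [List.length_cons, hcc]
        omega
    · simp only [blocks, if_neg h] at hA
      have hcc : (a :: l).count n = l.count n := by
        simp [List.count_cons, h]
      cases hA with
      | head =>
        have := ih (headI_mem (blocks_ne_nil n l))
        simp only [List.length_cons, hcc]
        omega
      | tail _ h1 =>
        have := ih (List.mem_of_mem_tail h1)
        simp only [List.length_cons, hcc]
        omega

/-- The generalized stack-sorting map `fast` (the convention in which a letter may
sit on top of a copy of itself in the stack): `fast ε = ε`, and if
`w = A₁ n A₂ n ⋯ n A_{k+1}` where `n` is the largest letter of `w` (occurring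
`k` times) and the `Aᵢ` contain only letters smaller than `n`, then
`fast w = fast A₁ ++ fast A₂ ++ ⋯ ++ fast A_{k+1} ++ n ⋯ n` (with `k` copies of `n`). -/
def fast (w : List ℕ) : List ℕ :=
  if h : w = [] then []
  else
    ((blocks (w.foldr max 0) w).attach.map
      fun (A : {x // x ∈ blocks (w.foldr max 0) w}) =>
      have : A.1.length < w.length := by
        have h1 := blocks_length A.2
        have h2 : 0 < w.count (w.foldr max 0) :=
          List.count_pos_iff.mpr (foldr_max_mem h)
        omega
      fast A.1).flatten ++ List.replicate (w.count (w.foldr max 0)) (w.foldr max 0)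
termination_by w.length

/-- Membership in `W_c`: `w` is a word over the positive integers with exactly
`cᵢ` copies of the letter `i` for each `1 ≤ i ≤ n = c.length` (and no other letters). -/
def InW (c : List ℕ) (w : List ℕ) : Prop :=
  0 ∉ w ∧ ∀ i : ℕ, w.count (i + 1) = c.getD i 0

/-- The identity word `Id_c = 1^{c₁} 2^{c₂} ⋯ n^{c_n}`, the unique word in `W_c`
whose letters are nondecreasing from left to right. -/
def idWord (c : List ℕ) : List ℕ :=
  ((List.range c.length).map fun i => List.replicate (c.getD i 0) (i + 1)).flatten

/-- `w` contains the pattern `231`: there are indices `a < b < c` with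
`w_c < w_a < w_b`. -/
def Contains231 (w : List ℕ) : Prop :=
  ∃ a b c : ℕ, a < b ∧ b < c ∧ c < w.length ∧
    w.getD c 0 < w.getD a 0 ∧ w.getD a 0 < w.getD b 0

/-- `w` contains the pattern `221`: there are indices `a < b < c` with
`w_c < w_a = w_b`. -/
def Contains221 (w : List ℕ) : Prop :=
  ∃ a b c : ℕ, a < b ∧ b < c ∧ c < w.length ∧
    w.getD c 0 < w.getD a 0 ∧ w.getD a 0 = w.getD b 0

open scoped List

lemma contains231_iff_exists_sublist {w : List ℕ} :
    Contains231 w ↔ ∃ x y z : ℕ, z < x ∧ x < y ∧ [x, y, z] <+ w := by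
  constructor
  · rintro ⟨a, b, c, hab, hbc, hc, h₁, h₂⟩
    refine ⟨_, _, _, h₁, h₂, ?_⟩
    have hb : b < w.length := hbc.trans hc
    have ha : a < w.length := hab.trans hb
    rw [List.getD_eq_getElem _ _ ha, List.getD_eq_getElem _ _ hb, List.getD_eq_getElem _ _ hc]
    have hleft : [w[a]] <+ w.take b :=
      List.singleton_sublist.mpr (List.mem_take_iff_getElem.mpr ⟨a, by omega, rfl⟩)
    have hright : [w[c]] <+ w.drop (b + 1) :=
      List.singleton_sublist.mpr
        (List.mem_drop_iff_getElem.mpr ⟨c - (b + 1), by omega, by congr 1; omega⟩)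
    exact (hleft.append (hright.cons_cons w[b])).trans (by simp)
  · rintro ⟨x, y, z, hzx, hxy, h⟩
    obtain ⟨f, hf⟩ := List.sublist_iff_exists_fin_orderEmbedding_get_eq.mp h
    have h₀ : x = w.get (f ⟨0, by simp⟩) := hf ⟨0, by simp⟩
    have h₁ : y = w.get (f ⟨1, by simp⟩) := hf ⟨1, by simp⟩
    have h₂ : z = w.get (f ⟨2, by simp⟩) := hf ⟨2, by simp⟩
    refine ⟨f ⟨0, by simp⟩, f ⟨1, by simp⟩, f ⟨2, by simp⟩, ?_, ?_, (f _).2, ?_, ?_⟩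
    · exact f.strictMono (by simp)
    · exact f.strictMono (by simp [Fin.lt_def])
    · rw [List.getD_eq_getElem _ _ (f _).2, List.getD_eq_getElem _ _ (f _).2]
      simpa only [h₀, h₂, List.get_eq_getElem] using hzx
    · rw [List.getD_eq_getElem _ _ (f _).2, List.getD_eq_getElem _ _ (f _).2]
      simpa only [h₀, h₁, List.get_eq_getElem] using hxy

lemma Contains231.of_sublist {u w : List ℕ} (hu : Contains231 u) (h : u <+ w) :
    Contains231 w := by
  rw [contains231_iff_exists_sublist] at hu ⊢
  obtain ⟨x, y, z, hzx, hxy, hs⟩ := hu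
  exact ⟨x, y, z, hzx, hxy, hs.trans h⟩

lemma blocks_cons_self (n : ℕ) (l : List ℕ) : blocks n (n :: l) = [] :: blocks n l := by
  simp [blocks]

lemma exists_blocks_eq_cons (n : ℕ) (l : List ℕ) : ∃ H T, blocks n l = H :: T :=
  List.exists_cons_of_ne_nil (blocks_ne_nil n l)

lemma blocks_cons_of_ne {n a : ℕ} {l H : List ℕ} {T : List (List ℕ)} (ha : a ≠ n)
    (h : blocks n l = H :: T) : blocks n (a :: l) = (a :: H) :: T := by
  simp [blocks, ha, h]

lemma flatten_blocks_perm (n : ℕ) (w : List ℕ) :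
    (blocks n w).flatten ++ List.replicate (w.count n) n ~ w := by
  induction w with
  | nil => simp [blocks]
  | cons a l ih =>
    by_cases ha : a = n
    · subst ha
      rw [blocks_cons_self, List.count_cons_self, List.replicate_succ]
      exact List.perm_middle.trans (ih.cons a)
    · obtain ⟨H, T, h⟩ := exists_blocks_eq_cons n l
      rw [blocks_cons_of_ne ha h, List.count_cons_of_ne ha]
      rw [h] at ih
      simpa using ih

lemma exists_mem_blocks {n z : ℕ} {w : List ℕ} (hz : z ∈ w) (hzn : z ≠ n) :
    ∃ A ∈ blocks n w, z ∈ A := by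
  have := (flatten_blocks_perm n w).mem_iff.mpr hz
  simpa [hzn] using this

lemma head_block_sublist {n : ℕ} {w H : List ℕ} {T : List (List ℕ)}
    (h : blocks n w = H :: T) : H <+ w := by
  induction w generalizing H T with
  | nil => simp_all [blocks]
  | cons a l ih =>
    by_cases ha : a = n
    · subst ha
      rw [blocks_cons_self] at h
      simp_all
    · obtain ⟨H', T', h'⟩ := exists_blocks_eq_cons n l
      rw [blocks_cons_of_ne ha h'] at h
      obtain ⟨rfl, rfl⟩ := List.cons.inj h
      exact (ih h').cons_cons a

lemma sublist_of_mem_blocks {n : ℕ} {w A : List ℕ} (hA : A ∈ blocks n w) : A <+ w := by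
  induction w generalizing A with
  | nil => simp_all [blocks]
  | cons a l ih =>
    obtain ⟨H, T, h⟩ := exists_blocks_eq_cons n l
    by_cases ha : a = n
    · subst ha
      rw [blocks_cons_self, List.mem_cons] at hA
      rcases hA with rfl | hA
      · simp
      · exact (ih hA).cons a
    · rw [blocks_cons_of_ne ha h, List.mem_cons] at hA
      rcases hA with rfl | hA
      · exact (head_block_sublist h).cons_cons a
      · exact (ih (h ▸ List.mem_cons_of_mem H hA)).cons a

lemma blocks_pairwise_sublist (n : ℕ) (w : List ℕ) :
    (blocks n w).Pairwise fun A B => A ++ n :: B <+ w := by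
  induction w with
  | nil => simp [blocks]
  | cons a l ih =>
    by_cases ha : a = n
    · subst ha
      rw [blocks_cons_self, List.pairwise_cons]
      exact ⟨fun B hB => (sublist_of_mem_blocks hB).cons_cons a, ih.imp fun h => h.cons a⟩
    · obtain ⟨H, T, h⟩ := exists_blocks_eq_cons n l
      rw [blocks_cons_of_ne ha h]
      rw [h, List.pairwise_cons] at ih
      exact List.pairwise_cons.mpr
        ⟨fun B hB => (ih.1 B hB).cons_cons a, ih.2.imp fun h => h.cons a⟩

lemma pair_sublist_head_block_or_mem_tail {n y z : ℕ} {w H : List ℕ} {T : List (List ℕ)}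
    (h : blocks n w = H :: T) (hs : [y, z] <+ w) (hzn : z ≠ n) :
    [y, z] <+ H ∨ ∃ B ∈ T, z ∈ B := by
  induction w generalizing H T with
  | nil => simp at hs
  | cons a l ih =>
    by_cases ha : a = n
    · subst ha
      rw [blocks_cons_self] at h
      obtain ⟨rfl, rfl⟩ := List.cons.inj h
      refine Or.inr (exists_mem_blocks ?_ hzn)
      exact hs.tail.subset (by simp)
    · obtain ⟨H', T', h'⟩ := exists_blocks_eq_cons n l
      rw [blocks_cons_of_ne ha h'] at h
      obtain ⟨rfl, rfl⟩ := List.cons.inj h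
      rcases List.sublist_cons_iff.mp hs with hs | ⟨r, hr, hs⟩
      · exact (ih h' hs).imp_left fun h => h.cons a
      · obtain ⟨rfl, rfl⟩ := List.cons.inj hr
        obtain ⟨B, hB, hzB⟩ := exists_mem_blocks (hs.subset (by simp)) hzn
        rw [h', List.mem_cons] at hB
        rcases hB with rfl | hB
        · exact Or.inl ((List.singleton_sublist.mpr hzB).cons_cons y)
        · exact Or.inr ⟨B, hB, hzB⟩

/-- A word with letters at most `n` avoids `231` if and only if every block between
occurrences of `n` does and the letters of earlier blocks are at most those of later ones. -/
lemma not_contains231_iff_blocks {n : ℕ} {w : List ℕ} (hn : ∀ x ∈ w, x ≤ n) :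
    ¬Contains231 w ↔ (∀ A ∈ blocks n w, ¬Contains231 A) ∧
      (blocks n w).Pairwise fun A B => ∀ x ∈ A, ∀ z ∈ B, x ≤ z := by
  constructor
  · refine fun hw => ⟨fun A hA h => hw (h.of_sublist (sublist_of_mem_blocks hA)), ?_⟩
    have hne : ∀ A ∈ blocks n w, ∀ x ∈ A, x ≠ n := by
      clear hw hn
      induction w with
      | nil => simp [blocks]
      | cons a l ih =>
        obtain ⟨H, T, h⟩ := exists_blocks_eq_cons n l
        by_cases ha : a = n
        · subst ha
          rw [blocks_cons_self]
          simpa using ih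
        · rw [blocks_cons_of_ne ha h]
          rw [h, List.forall_mem_cons] at ih
          exact List.forall_mem_cons.mpr ⟨List.forall_mem_cons.mpr ⟨ha, ih.1⟩, ih.2⟩
    refine (blocks_pairwise_sublist n w).imp_of_mem fun {A B} hA _ hs x hx z hz => ?_
    by_contra! hzx
    refine hw (contains231_iff_exists_sublist.mpr ⟨x, n, z, hzx, ?_, ?_⟩)
    · exact lt_of_le_of_ne (hn x ((sublist_of_mem_blocks hA).subset hx)) (hne A hA x hx)
    · exact ((List.singleton_sublist.mpr hx).append
        ((List.singleton_sublist.mpr hz).cons_cons n)).trans hs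
  · rintro ⟨hblocks, hpair⟩
    induction w with
    | nil => simp [contains231_iff_exists_sublist]
    | cons a l ih =>
      have hl : ∀ x ∈ l, x ≤ n := fun x hx => hn x (List.mem_cons_of_mem a hx)
      intro hw
      obtain ⟨x, y, z, hzx, hxy, hs⟩ := contains231_iff_exists_sublist.mp hw
      have hxn : x < n := hxy.trans_le (hn y (hs.subset (by simp)))
      by_cases ha : a = n
      · subst ha
        rw [blocks_cons_self, List.pairwise_cons] at hpair
        rw [blocks_cons_self] at hblocks
        refine ih hl (fun A hA => hblocks A (List.mem_cons_of_mem _ hA)) hpair.2 ?_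
        refine contains231_iff_exists_sublist.mpr ⟨x, y, z, hzx, hxy, ?_⟩
        exact (List.sublist_cons_iff.mp hs).resolve_right (by simp [hxn.ne])
      · obtain ⟨H, T, h⟩ := exists_blocks_eq_cons n l
        rw [blocks_cons_of_ne ha h, List.pairwise_cons] at hpair
        rw [blocks_cons_of_ne ha h, List.forall_mem_cons] at hblocks
        rcases List.sublist_cons_iff.mp hs with hs | ⟨r, hr, hs⟩
        · refine ih hl ?_ ?_ (contains231_iff_exists_sublist.mpr ⟨x, y, z, hzx, hxy, hs⟩)
          · rw [h, List.forall_mem_cons]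
            exact ⟨fun hH => hblocks.1 (hH.of_sublist (List.sublist_cons_self a H)), hblocks.2⟩
          · rw [h, List.pairwise_cons]
            exact ⟨fun B hB u hu => hpair.1 B hB u (List.mem_cons_of_mem a hu), hpair.2⟩
        · obtain ⟨rfl, rfl⟩ := List.cons.inj hr
          rcases pair_sublist_head_block_or_mem_tail h hs (hzx.trans hxn).ne with hH | ⟨B, hB, hz⟩
          · exact hblocks.1
              (contains231_iff_exists_sublist.mpr ⟨x, y, z, hzx, hxy, hH.cons_cons x⟩)
          · exact absurd (hpair.1 B hB x (by simp) z hz) (by omega)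

lemma le_foldr_max {w : List ℕ} {x : ℕ} (hx : x ∈ w) : x ≤ w.foldr max 0 := by
  induction w with
  | nil => simp at hx
  | cons a l ih =>
    rcases List.mem_cons.mp hx with rfl | hx
    · exact le_max_left _ _
    · exact (ih hx).trans (le_max_right _ _)

lemma fast_of_ne_nil {w : List ℕ} (hw : w ≠ []) :
    fast w = ((blocks (w.foldr max 0) w).map fast).flatten ++
      List.replicate (w.count (w.foldr max 0)) (w.foldr max 0) := by
  rw [fast, dif_neg hw]
  simp

lemma length_lt_of_mem_blocks_max {w A : List ℕ} (hw : w ≠ [])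
    (hA : A ∈ blocks (w.foldr max 0) w) : A.length < w.length := by
  have h₁ := blocks_length hA
  have h₂ : 0 < w.count (w.foldr max 0) := List.count_pos_iff.mpr (foldr_max_mem hw)
  omega

lemma fast_perm (w : List ℕ) : fast w ~ w := by
  rcases eq_or_ne w [] with rfl | hw
  · simp [fast]
  · rw [fast_of_ne_nil hw]
    refine (List.Perm.append_right _ (List.Perm.flatten_congr ?_)).trans (flatten_blocks_perm _ w)
    rw [List.forall₂_map_left_iff, List.forall₂_same]
    intro A hA
    have := length_lt_of_mem_blocks_max hw hA
    exact fast_perm A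
termination_by w.length

lemma fast_pairwise_le_iff (w : List ℕ) : (fast w).Pairwise (· ≤ ·) ↔ ¬Contains231 w := by
  rcases eq_or_ne w [] with rfl | hw
  · simp [fast, contains231_iff_exists_sublist]
  · have hn : ∀ x ∈ w, x ≤ w.foldr max 0 := fun x hx => le_foldr_max hx
    have hlast : ∀ x ∈ ((blocks (w.foldr max 0) w).map fast).flatten, x ≤ w.foldr max 0 := by
      intro x hx
      refine hn x ((fast_perm w).subset ?_)
      rw [fast_of_ne_nil hw]
      exact List.mem_append_left _ hx
    have hrec : ∀ A ∈ blocks (w.foldr max 0) w,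
        ((fast A).Pairwise (· ≤ ·) ↔ ¬Contains231 A) := fun A hA =>
      have := length_lt_of_mem_blocks_max hw hA
      fast_pairwise_le_iff A
    rw [not_contains231_iff_blocks hn, fast_of_ne_nil hw, List.pairwise_append,
      List.pairwise_flatten, List.forall_mem_map, List.pairwise_map, ← forall₂_congr hrec]
    simp only [(fast_perm _).mem_iff]
    refine and_iff_left ⟨List.pairwise_replicate.mpr (Or.inr le_rfl), fun x hx y hy => ?_⟩
    rw [List.eq_of_mem_replicate hy]
    exact hlast x hx
termination_by w.length

lemma idWord_pairwise_le (c : List ℕ) : (idWord c).Pairwise (· ≤ ·) := by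
  rw [idWord, List.pairwise_flatten, List.forall_mem_map, List.pairwise_map]
  refine ⟨fun i _ => List.pairwise_replicate.mpr (Or.inr le_rfl), ?_⟩
  refine List.pairwise_lt_range.imp fun hij x hx y hy => ?_
  rw [List.eq_of_mem_replicate hx, List.eq_of_mem_replicate hy]
  omega

lemma count_idWord_zero (c : List ℕ) : (idWord c).count 0 = 0 := by
  rw [List.count_eq_zero]
  simp [idWord]

lemma count_idWord_succ (c : List ℕ) (i : ℕ) : (idWord c).count (i + 1) = c.getD i 0 := by
  have hrange : ∀ m, (((List.range m).map fun j =>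
      List.replicate (c.getD j 0) (j + 1)).flatten).count (i + 1) =
        if i < m then c.getD i 0 else 0 := by
    intro m
    induction m with
    | zero => simp
    | succ m ih =>
      rw [List.range_succ, List.map_append, List.flatten_append, List.count_append, ih]
      simp only [List.map_cons, List.map_nil, List.flatten_cons, List.flatten_nil,
        List.append_nil, List.count_replicate, beq_iff_eq]
      rcases lt_trichotomy i m with h | rfl | h
      · rw [if_pos h, if_neg (by omega), if_pos (by omega), add_zero]
      · simp
      · rw [if_neg (by omega), if_neg (by omega), if_neg (by omega)]
  rw [idWord, hrange]
  split_ifs with h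
  · rfl
  · exact (List.getD_eq_default _ _ (not_lt.mp h)).symm

lemma InW.perm_idWord {c w : List ℕ} (hw : InW c w) : w ~ idWord c := by
  rw [List.perm_iff_count]
  rintro (_ | i)
  · rw [count_idWord_zero, List.count_eq_zero.mpr hw.1]
  · rw [count_idWord_succ, hw.2]

/-- Let `c = (c₁, …, c_n)` be a tuple of nonnegative integers and let `w ∈ W_c`.
Then `fast w = Id_c` if and only if `w` avoids the pattern `231`. -/
theorem fast_sortable_iff_avoids_231 (c : List ℕ) (w : List ℕ) (hw : InW c w) :
    fast w = idWord c ↔ ¬Contains231 w := by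
  rw [← fast_pairwise_le_iff]
  refine ⟨fun h => h ▸ idWord_pairwise_le c, fun h => ?_⟩
  exact ((fast_perm w).trans hw.perm_idWord).eq_of_pairwise' h (idWord_pairwise_le c)
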